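/- Let (H, α) be a monoidal Hom-Hopf T-coalgebra over G with bijective antipode, (M, μ) ∈ YD_p, (N, ν) ∈ YD_q, (X, η) ∈ YD_s. With ^MN = ^pN, ^MX = ^pX, c as defined, and the Hom-associator ã_{A,B,C}((a ⊗ b) ⊗ c) = φ_A(a) ⊗ (b ⊗ φ_C^{-1}(c)) (φ_A, φ_C the structure automorphisms of A, C), the first hexagon axiom holds: (id_{^MN} ⊗ c_{M,X}) ∘ ã_{^MN,M,X} ∘ (c_{M,N} ⊗ id_X) = ã_{^MN,^MX,M} ∘ c_{M,N⊗X} ∘ ã_{M,N,X}, as maps (M ⊗ N) ⊗ X → ^MN ⊗ (^MX ⊗ M), where ^M(N ⊗ X) is identified with ^MN ⊗ ^MX. -/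

import Mathlib

open TensorProduct

noncomputable section

section Cast

variable (k : Type*) [Field k] {G : Type*} [Group G] {H : G → Type*}
  [∀ p, AddCommGroup (H p)] [∀ p, Module k (H p)]

/-- Transport of components along an equality of group elements. -/
def cst {a b : G} (h : a = b) : H a →ₗ[k] H b := by subst h; exact LinearMap.id

/-- Transport of components along an equality of group elements, as a linear equivalence. -/
def cstE {a b : G} (h : a = b) : H a ≃ₗ[k] H b := by subst h; exact LinearEquiv.refl k (H a)

end Cast

/-- A (classical) Hopf group-coalgebra over a group `G`. -/
structure HopfGC (k : Type*) [Field k] (G : Type*) [Group G] (H : G → Type*)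
    [∀ p, AddCommGroup (H p)] [∀ p, Module k (H p)] where
  mul : ∀ p : G, H p →ₗ[k] H p →ₗ[k] H p
  one : ∀ p : G, H p
  comul : ∀ p q : G, H (p * q) →ₗ[k] H p ⊗[k] H q
  counit : H (1 : G) →ₗ[k] k
  antipode : ∀ p : G, H p →ₗ[k] H p⁻¹
  mul_assoc' : ∀ (p : G) (a b c : H p), mul p (mul p a b) c = mul p a (mul p b c)
  one_mul' : ∀ (p : G) (a : H p), mul p (one p) a = a
  mul_one' : ∀ (p : G) (a : H p), mul p a (one p) = a
  coassoc : ∀ p q r : G,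
    (TensorProduct.assoc k (H p) (H q) (H r)).toLinearMap.comp
      ((TensorProduct.map (comul p q) LinearMap.id).comp (comul (p * q) r))
    = (TensorProduct.map LinearMap.id (comul q r)).comp
        ((comul p (q * r)).comp (cst k (mul_assoc p q r)))
  counit_comul' : ∀ (p : G) (c : H p),
    (TensorProduct.lid k (H p))
      ((TensorProduct.map counit LinearMap.id) (comul 1 p (cst k (one_mul p).symm c))) = c
  comul_counit' : ∀ (p : G) (c : H p),
    (TensorProduct.rid k (H p))
      ((TensorProduct.map LinearMap.id counit) (comul p 1 (cst k (mul_one p).symm c))) = c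
  comul_mul : ∀ (p q : G) (a b : H (p * q)),
    comul p q (mul (p * q) a b)
      = TensorProduct.map₂ (mul p) (mul q) (comul p q a) (comul p q b)
  comul_one : ∀ p q : G, comul p q (one (p * q)) = (one p) ⊗ₜ[k] (one q)
  counit_mul : ∀ a b : H (1 : G), counit (mul 1 a b) = counit a * counit b
  counit_one : counit (one 1) = 1
  antipode_left : ∀ (p : G) (h : H (1 : G)),
    TensorProduct.lift (mul p)
      ((TensorProduct.map ((cst k (inv_inv p)).comp (antipode p⁻¹)) LinearMap.id)
        (comul p⁻¹ p (cst k (show (1 : G) = p⁻¹ * p by group) h)))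
    = counit h • one p
  antipode_right : ∀ (p : G) (h : H (1 : G)),
    TensorProduct.lift (mul p)
      ((TensorProduct.map LinearMap.id ((cst k (inv_inv p)).comp (antipode p⁻¹)))
        (comul p p⁻¹ (cst k (show (1 : G) = p * p⁻¹ by group) h)))
    = counit h • one p

/-- An automorphism of a Hopf group-coalgebra. -/
structure HopfGCAut {k : Type*} [Field k] {G : Type*} [Group G] {H : G → Type*}
    [∀ p, AddCommGroup (H p)] [∀ p, Module k (H p)] (D : HopfGC k G H) where
  α : ∀ p : G, H p ≃ₗ[k] H p
  map_mul : ∀ (p : G) (a b : H p), α p (D.mul p a b) = D.mul p (α p a) (α p b)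
  map_one : ∀ p : G, α p (D.one p) = D.one p
  map_comul : ∀ (p q : G) (c : H (p * q)),
    TensorProduct.map (α p).toLinearMap (α q).toLinearMap (D.comul p q c)
      = D.comul p q (α (p * q) c)
  map_counit : ∀ c : H (1 : G), D.counit (α 1 c) = D.counit c
  map_antipode : ∀ (p : G) (h : H p), D.antipode p (α p h) = α p⁻¹ (D.antipode p h)

/-- The axioms of a group-cograded monoidal Hom-Hopf algebra, for given structure data. -/
structure IsGCHH (k : Type*) [Field k] {G : Type*} [Group G] {H : G → Type*}
    [∀ p, AddCommGroup (H p)] [∀ p, Module k (H p)]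
    (mul : ∀ p : G, H p →ₗ[k] H p →ₗ[k] H p) (one : ∀ p : G, H p)
    (comul : ∀ p q : G, H (p * q) →ₗ[k] H p ⊗[k] H q) (counit : H (1 : G) →ₗ[k] k)
    (antipode : ∀ p : G, H p →ₗ[k] H p⁻¹) (α : ∀ p : G, H p ≃ₗ[k] H p) : Prop where
  hom_assoc : ∀ (p : G) (a b c : H p), mul p (α p a) (mul p b c) = mul p (mul p a b) (α p c)
  one_mul' : ∀ (p : G) (a : H p), mul p (one p) a = α p a
  mul_one' : ∀ (p : G) (a : H p), mul p a (one p) = α p a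
  α_mul : ∀ (p : G) (a b : H p), α p (mul p a b) = mul p (α p a) (α p b)
  α_one : ∀ p : G, α p (one p) = one p
  hcoassoc : ∀ p q r : G,
    (TensorProduct.map (α p).symm.toLinearMap (comul q r)).comp
      ((comul p (q * r)).comp (cst k (mul_assoc p q r)))
    = (TensorProduct.assoc k (H p) (H q) (H r)).toLinearMap.comp
        ((TensorProduct.map (comul p q) (α r).symm.toLinearMap).comp (comul (p * q) r))
  counit_comul' : ∀ (p : G) (c : H p),
    (TensorProduct.lid k (H p))
      ((TensorProduct.map counit LinearMap.id) (comul 1 p (cst k (one_mul p).symm c)))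
    = (α p).symm c
  comul_counit' : ∀ (p : G) (c : H p),
    (TensorProduct.rid k (H p))
      ((TensorProduct.map LinearMap.id counit) (comul p 1 (cst k (mul_one p).symm c)))
    = (α p).symm c
  comul_αinv : ∀ (p q : G) (c : H (p * q)),
    comul p q ((α (p * q)).symm c)
      = TensorProduct.map (α p).symm.toLinearMap (α q).symm.toLinearMap (comul p q c)
  counit_αinv : ∀ c : H (1 : G), counit ((α 1).symm c) = counit c
  comul_mul : ∀ (p q : G) (a b : H (p * q)),
    comul p q (mul (p * q) a b)
      = TensorProduct.map₂ (mul p) (mul q) (comul p q a) (comul p q b)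
  comul_one : ∀ p q : G, comul p q (one (p * q)) = (one p) ⊗ₜ[k] (one q)
  counit_mul : ∀ a b : H (1 : G), counit (mul 1 a b) = counit a * counit b
  counit_one : counit (one 1) = 1
  antipode_α : ∀ (p : G) (h : H p), antipode p (α p h) = (α p⁻¹) (antipode p h)
  antipode_left : ∀ (p : G) (h : H (1 : G)),
    TensorProduct.lift (mul p)
      ((TensorProduct.map ((cst k (inv_inv p)).comp (antipode p⁻¹)) LinearMap.id)
        (comul p⁻¹ p (cst k (show (1 : G) = p⁻¹ * p by group) h)))
    = counit h • one p
  antipode_right : ∀ (p : G) (h : H (1 : G)),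
    TensorProduct.lift (mul p)
      ((TensorProduct.map LinearMap.id ((cst k (inv_inv p)).comp (antipode p⁻¹)))
        (comul p p⁻¹ (cst k (show (1 : G) = p * p⁻¹ by group) h)))
    = counit h • one p

/-- The axioms of a crossing on a group-cograded (monoidal Hom-)Hopf algebra. -/
structure IsCrossing (k : Type*) [Field k] {G : Type*} [Group G] {H : G → Type*}
    [∀ p, AddCommGroup (H p)] [∀ p, Module k (H p)]
    (mul : ∀ p : G, H p →ₗ[k] H p →ₗ[k] H p) (one : ∀ p : G, H p)
    (comul : ∀ p q : G, H (p * q) →ₗ[k] H p ⊗[k] H q) (counit : H (1 : G) →ₗ[k] k)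
    (α : ∀ p : G, H p ≃ₗ[k] H p)
    (π : ∀ q p : G, H p ≃ₗ[k] H (q * p * q⁻¹)) : Prop where
  π_mul : ∀ (q p : G) (a b : H p),
    π q p (mul p a b) = mul (q * p * q⁻¹) (π q p a) (π q p b)
  π_one : ∀ q p : G, π q p (one p) = one (q * p * q⁻¹)
  π_α : ∀ (q p : G) (a : H p), π q p (α p a) = α (q * p * q⁻¹) (π q p a)
  π_comul : ∀ (q a b : G) (c : H (a * b)),
    TensorProduct.map (π q a).toLinearMap (π q b).toLinearMap (comul a b c)
      = comul (q * a * q⁻¹) (q * b * q⁻¹)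
          (cst k (show q * (a * b) * q⁻¹ = (q * a * q⁻¹) * (q * b * q⁻¹) by group) (π q (a * b) c))
  π_counit : ∀ (q : G) (c : H (1 : G)),
    counit (cst k (show q * (1 : G) * q⁻¹ = 1 by group) (π q 1 c)) = counit c
  π_mult : ∀ (a b p : G) (c : H p),
    cst k (show (a * b) * p * (a * b)⁻¹ = a * (b * p * b⁻¹) * a⁻¹ by group) (π (a * b) p c)
      = π a (b * p * b⁻¹) (π b p c)

/-- A (classical) Hopf `T`-coalgebra: a Hopf group-coalgebra with a crossing. -/
structure HopfTC (k : Type*) [Field k] (G : Type*) [Group G] (H : G → Type*)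
    [∀ p, AddCommGroup (H p)] [∀ p, Module k (H p)] extends HopfGC k G H where
  π : ∀ q p : G, H p ≃ₗ[k] H (q * p * q⁻¹)
  π_mul : ∀ (q p : G) (a b : H p),
    π q p (mul p a b) = mul (q * p * q⁻¹) (π q p a) (π q p b)
  π_one : ∀ q p : G, π q p (one p) = one (q * p * q⁻¹)
  π_comul : ∀ (q a b : G) (c : H (a * b)),
    TensorProduct.map (π q a).toLinearMap (π q b).toLinearMap (comul a b c)
      = comul (q * a * q⁻¹) (q * b * q⁻¹)
          (cst k (show q * (a * b) * q⁻¹ = (q * a * q⁻¹) * (q * b * q⁻¹) by group) (π q (a * b) c))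
  π_counit : ∀ (q : G) (c : H (1 : G)),
    counit (cst k (show q * (1 : G) * q⁻¹ = 1 by group) (π q 1 c)) = counit c
  π_antipode : ∀ (q p : G) (h : H p),
    antipode (q * p * q⁻¹) (π q p h)
      = cst k (show q * p⁻¹ * q⁻¹ = (q * p * q⁻¹)⁻¹ by group) (π q p⁻¹ (antipode p h))
  π_mult : ∀ (a b p : G) (c : H p),
    cst k (show (a * b) * p * (a * b)⁻¹ = a * (b * p * b⁻¹) * a⁻¹ by group) (π (a * b) p c)
      = π a (b * p * b⁻¹) (π b p c)

/-- A group-cograded monoidal Hom-Hopf algebra (bundled data). -/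
structure GCHH (k : Type*) [Field k] (G : Type*) [Group G] (H : G → Type*)
    [∀ p, AddCommGroup (H p)] [∀ p, Module k (H p)] where
  mul : ∀ p : G, H p →ₗ[k] H p →ₗ[k] H p
  one : ∀ p : G, H p
  comul : ∀ p q : G, H (p * q) →ₗ[k] H p ⊗[k] H q
  counit : H (1 : G) →ₗ[k] k
  antipode : ∀ p : G, H p →ₗ[k] H p⁻¹
  α : ∀ p : G, H p ≃ₗ[k] H p
  ax : IsGCHH k mul one comul counit antipode α

/-- A monoidal Hom-Hopf `T`-coalgebra with bijective antipode (bundled data). -/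
structure HomTC (k : Type*) [Field k] (G : Type*) [Group G] (H : G → Type*)
    [∀ p, AddCommGroup (H p)] [∀ p, Module k (H p)] where
  mul : ∀ p : G, H p →ₗ[k] H p →ₗ[k] H p
  one : ∀ p : G, H p
  comul : ∀ p q : G, H (p * q) →ₗ[k] H p ⊗[k] H q
  counit : H (1 : G) →ₗ[k] k
  antipode : ∀ p : G, H p ≃ₗ[k] H p⁻¹
  α : ∀ p : G, H p ≃ₗ[k] H p
  π : ∀ q p : G, H p ≃ₗ[k] H (q * p * q⁻¹)
  ax : IsGCHH k mul one comul counit (fun p => (antipode p).toLinearMap) α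
  cax : IsCrossing k mul one comul counit α π

section YD

variable {k : Type*} [Field k] {G : Type*} [Group G] {H : G → Type*}
  [∀ p, AddCommGroup (H p)] [∀ p, Module k (H p)]

variable (k)

/-- The Yetter-Drinfeld compatibility condition (3) of Definition 4.1. -/
def YDcompat (T : HomTC k G H) (p : G) {M : Type*} [AddCommGroup M] [Module k M]
    (μ : M ≃ₗ[k] M) (act : H p →ₗ[k] M →ₗ[k] M)
    (ρ : ∀ r : G, M →ₗ[k] M ⊗[k] H r) : Prop :=
  ∀ r : G,
    (TensorProduct.map (TensorProduct.lift act) (TensorProduct.lift (T.mul r))).comp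
      ((TensorProduct.tensorTensorTensorComm k (H p) (H r) M (H r)).toLinearMap.comp
        (TensorProduct.map (T.comul p r) (ρ r)))
    =
    (TensorProduct.map μ.toLinearMap (TensorProduct.lift (T.mul r))).comp
      ((TensorProduct.assoc k M (H r) (H r)).toLinearMap.comp
        (((TensorProduct.comm k (H r) (M ⊗[k] H r)).toLinearMap).comp
          ((TensorProduct.map
              ((cst k (show p⁻¹ * (p * r * p⁻¹) * p⁻¹⁻¹ = r by group)).comp
                (T.π p⁻¹ (p * r * p⁻¹)).toLinearMap)
              ((ρ r).comp (TensorProduct.lift act))).comp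
            ((TensorProduct.assoc k (H (p * r * p⁻¹)) (H p) M).toLinearMap.comp
              (TensorProduct.map
                ((T.comul (p * r * p⁻¹) p).comp
                  (cst k (show p * r = (p * r * p⁻¹) * p by group)))
                μ.symm.toLinearMap)))))

/-- The axioms of a (left-right) `p`-Yetter-Drinfeld module over a monoidal Hom-Hopf
`T`-coalgebra. -/
structure IsYD (T : HomTC k G H) (p : G) {M : Type*} [AddCommGroup M] [Module k M]
    (μ : M ≃ₗ[k] M) (act : H p →ₗ[k] M →ₗ[k] M)
    (ρ : ∀ r : G, M →ₗ[k] M ⊗[k] H r) : Prop where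
  act_act : ∀ (a b : H p) (m : M), act (T.α p a) (act b m) = act (T.mul p a b) (μ m)
  act_one : ∀ m : M, act (T.one p) m = μ m
  μ_act : ∀ (a : H p) (m : M), μ (act a m) = act (T.α p a) (μ m)
  ρ_coassoc : ∀ a b : G,
    (TensorProduct.map μ.symm.toLinearMap (T.comul a b)).comp (ρ (a * b))
    = (TensorProduct.assoc k M (H a) (H b)).toLinearMap.comp
        ((TensorProduct.map (ρ a) (T.α b).symm.toLinearMap).comp (ρ b))
  ρ_counit : ∀ m : M,
    (TensorProduct.rid k M) ((TensorProduct.map LinearMap.id T.counit) (ρ 1 m)) = μ.symm m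
  ρ_μ : ∀ r : G,
    (ρ r).comp μ.toLinearMap
      = (TensorProduct.map μ.toLinearMap (T.α r).toLinearMap).comp (ρ r)
  compat : YDcompat k T p μ act ρ

/-- The action of `H (a*b)` on a tensor product of an `H a`-module and an `H b`-module. -/
def tAct (T : HomTC k G H) (a b : G) {M N : Type*} [AddCommGroup M] [Module k M]
    [AddCommGroup N] [Module k N]
    (actM : H a →ₗ[k] M →ₗ[k] M) (actN : H b →ₗ[k] N →ₗ[k] N) :
    H (a * b) →ₗ[k] (M ⊗[k] N) →ₗ[k] (M ⊗[k] N) :=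
  (TensorProduct.map₂ actM actN).comp (T.comul a b)

/-- The coaction on the tensor product `M ⊗ N`, where `N` has degree `b`:
`ρ r (m ⊗ n) = m₍₀₎ ⊗ n₍₀₎ ⊗ n₍₁,r₎ ⬝ π_{b⁻¹}(m₍₁,brb⁻¹₎)`. -/
def tCoact (T : HomTC k G H) (b : G) {M N : Type*} [AddCommGroup M] [Module k M]
    [AddCommGroup N] [Module k N]
    (ρM : ∀ r : G, M →ₗ[k] M ⊗[k] H r) (ρN : ∀ r : G, N →ₗ[k] N ⊗[k] H r) (r : G) :
    (M ⊗[k] N) →ₗ[k] (M ⊗[k] N) ⊗[k] H r :=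
  (TensorProduct.map LinearMap.id
      (TensorProduct.lift (((T.mul r).flip).comp
        ((cst k (show b⁻¹ * (b * r * b⁻¹) * b⁻¹⁻¹ = r by group)).comp
          (T.π b⁻¹ (b * r * b⁻¹)).toLinearMap)))).comp
    ((TensorProduct.tensorTensorTensorComm k M (H (b * r * b⁻¹)) N (H r)).toLinearMap.comp
      (TensorProduct.map (ρM (b * r * b⁻¹)) (ρN r)))

/-- The conjugate action on `ᵠM`: `h ⇀ m = π_{s⁻¹}(h) ⬝ m`. -/
def cAct (T : HomTC k G H) (s p : G) {M : Type*} [AddCommGroup M] [Module k M]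
    (act : H p →ₗ[k] M →ₗ[k] M) : H (s * p * s⁻¹) →ₗ[k] M →ₗ[k] M :=
  act.comp ((cst k (show s⁻¹ * (s * p * s⁻¹) * s⁻¹⁻¹ = p by group)).comp
    (T.π s⁻¹ (s * p * s⁻¹)).toLinearMap)

/-- The conjugate coaction on `ˢM`: `ρ r m = m₍₀₎ ⊗ π_s (m₍₁,s⁻¹rs₎)`. -/
def cCoact (T : HomTC k G H) (s : G) {M : Type*} [AddCommGroup M] [Module k M]
    (ρ : ∀ r : G, M →ₗ[k] M ⊗[k] H r) (r : G) : M →ₗ[k] M ⊗[k] H r :=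
  (TensorProduct.map LinearMap.id
      ((cst k (show s * (s⁻¹ * r * s) * s⁻¹ = r by group)).comp
        (T.π s (s⁻¹ * r * s)).toLinearMap)).comp
    (ρ (s⁻¹ * r * s))

/-- The Hom-associator `(A ⊗ B) ⊗ C ≃ A ⊗ (B ⊗ C)`, `(a ⊗ b) ⊗ c ↦ φA a ⊗ (b ⊗ φC⁻¹ c)`. -/
def homAssoc {A B C : Type*} [AddCommGroup A] [Module k A] [AddCommGroup B] [Module k B]
    [AddCommGroup C] [Module k C] (φA : A ≃ₗ[k] A) (φC : C ≃ₗ[k] C) :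
    (A ⊗[k] B) ⊗[k] C ≃ₗ[k] A ⊗[k] (B ⊗[k] C) :=
  (TensorProduct.assoc k A B C).trans
    (TensorProduct.congr φA (TensorProduct.congr (LinearEquiv.refl k B) φC.symm))

/-- The braiding `c_{M,W} : M ⊗ W → ᴹW ⊗ M`,
`m ⊗ w ↦ (S_{w⁻¹}(m₍₁,w⁻¹₎) ⬝ φW⁻¹ w) ⊗ μ m₍₀₎`, where `W` has degree `w`. -/
def braid (T : HomTC k G H) (w : G) {M W : Type*} [AddCommGroup M] [Module k M]
    [AddCommGroup W] [Module k W] (μ : M ≃ₗ[k] M) (ρM : ∀ r : G, M →ₗ[k] M ⊗[k] H r)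
    (actW : H w →ₗ[k] W →ₗ[k] W) (φW : W ≃ₗ[k] W) : (M ⊗[k] W) →ₗ[k] (W ⊗[k] M) :=
  (TensorProduct.comm k M W).toLinearMap.comp
    ((TensorProduct.map μ.toLinearMap
        (TensorProduct.lift (actW.comp
          ((cst k (inv_inv w)).comp (T.antipode w⁻¹).toLinearMap)))).comp
      ((TensorProduct.assoc k M (H w⁻¹) W).toLinearMap.comp
        (TensorProduct.map (ρM w⁻¹) φW.symm.toLinearMap)))

end YD

/-- The axioms of a monoidal Hom-Hopf algebra on a single space. -/
structure IsMonHomHopf (k : Type*) [Field k] (A : Type*) [AddCommGroup A] [Module k A]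
    (mul : A →ₗ[k] A →ₗ[k] A) (one : A) (comul : A →ₗ[k] A ⊗[k] A) (counit : A →ₗ[k] k)
    (S : A →ₗ[k] A) (α : A ≃ₗ[k] A) : Prop where
  hom_assoc : ∀ a b c : A, mul (α a) (mul b c) = mul (mul a b) (α c)
  one_mul' : ∀ a : A, mul one a = α a
  mul_one' : ∀ a : A, mul a one = α a
  α_mul : ∀ a b : A, α (mul a b) = mul (α a) (α b)
  α_one : α one = one
  hcoassoc :
    (TensorProduct.map α.symm.toLinearMap comul).comp comul
    = (TensorProduct.assoc k A A A).toLinearMap.comp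
        ((TensorProduct.map comul α.symm.toLinearMap).comp comul)
  counit_comul' : ∀ a : A,
    (TensorProduct.lid k A) ((TensorProduct.map counit LinearMap.id) (comul a)) = α.symm a
  comul_counit' : ∀ a : A,
    (TensorProduct.rid k A) ((TensorProduct.map LinearMap.id counit) (comul a)) = α.symm a
  comul_αinv : ∀ a : A,
    comul (α.symm a) = TensorProduct.map α.symm.toLinearMap α.symm.toLinearMap (comul a)
  counit_αinv : ∀ a : A, counit (α.symm a) = counit a
  comul_mul : ∀ a b : A, comul (mul a b) = TensorProduct.map₂ mul mul (comul a) (comul b)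
  comul_one : comul one = one ⊗ₜ[k] one
  counit_mul : ∀ a b : A, counit (mul a b) = counit a * counit b
  counit_one : counit one = 1
  antipode_α : ∀ a : A, S (α a) = α (S a)
  antipode_left : ∀ a : A,
    TensorProduct.lift mul ((TensorProduct.map S LinearMap.id) (comul a)) = counit a • one
  antipode_right : ∀ a : A,
    TensorProduct.lift mul ((TensorProduct.map LinearMap.id S) (comul a)) = counit a • one

@[simp] theorem cst_rfl {k : Type*} [Field k] {G : Type*} {H : G → Type*}
    [∀ p, AddCommGroup (H p)] [∀ p, Module k (H p)] {a : G} (h : a = a) :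
    cst (H := H) k h = LinearMap.id := rfl

section Antipode

variable {k : Type*} [Field k] {G : Type*} [Group G] {H : G → Type*}
  [∀ p, AddCommGroup (H p)] [∀ p, Module k (H p)]

theorem map_map_symm {A B : Type*} [AddCommGroup A] [Module k A] [AddCommGroup B]
    [Module k B] (f : A ≃ₗ[k] A) (g : B ≃ₗ[k] B) (t : A ⊗[k] B) :
    TensorProduct.map f.toLinearMap g.toLinearMap
      (TensorProduct.map f.symm.toLinearMap g.symm.toLinearMap t) = t := by
  induction t with
  | zero => simp
  | tmul a b => simp
  | add a b ha hb => simp only [map_add, ha, hb]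

namespace HomTC

variable (T : HomTC k G H)

/-- The comultiplication commutes with the structure automorphisms. -/
theorem comul_α (a b : G) (c : H (a * b)) :
    T.comul a b (T.α (a * b) c)
      = TensorProduct.map (T.α a).toLinearMap (T.α b).toLinearMap (T.comul a b c) := by
  have h := T.ax.comul_αinv a b (T.α (a * b) c)
  rw [LinearEquiv.symm_apply_apply] at h
  rw [h, map_map_symm]

/-- The untwisted comultiplication `Δ ∘ α`, indexed by a factorisation of the degree. -/
def ucomul {a b c : G} (h : a * b = c) : H c →ₗ[k] H a ⊗[k] H b :=
  (T.comul a b).comp ((cst k h.symm).comp (T.α c).toLinearMap)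

/-- The untwisted multiplication `α⁻¹ ∘ m`. -/
def umul (a : G) : H a →ₗ[k] H a →ₗ[k] H a := (T.mul a).compr₂ (T.α a).symm.toLinearMap

/-- The antipode, indexed by a pair of mutually inverse degrees. -/
def uantipode {a b : G} (h : a * b = 1) : H b →ₗ[k] H a :=
  (cst k (eq_inv_of_mul_eq_one_left h).symm).comp (T.antipode b).toLinearMap

theorem umul_assoc (p : G) (a b c : H p) :
    T.umul p (T.umul p a b) c = T.umul p a (T.umul p b c) := by
  apply (T.α p).injective
  apply (T.α p).injective
  simp only [umul, LinearMap.compr₂_apply, LinearEquiv.coe_coe, LinearEquiv.apply_symm_apply,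
    T.ax.α_mul, T.ax.hom_assoc]

theorem one_umul (p : G) (a : H p) : T.umul p (T.one p) a = a := by
  simp [umul, T.ax.one_mul']

theorem umul_one (p : G) (a : H p) : T.umul p a (T.one p) = a := by
  simp [umul, T.ax.mul_one']

theorem ucoassoc {a b c ab bc d : G} (hab : a * b = ab) (hbc : b * c = bc) (h : ab * c = d)
    (h' : a * bc = d) (x : H d) :
    TensorProduct.assoc k (H a) (H b) (H c)
        (TensorProduct.map (T.ucomul hab) LinearMap.id (T.ucomul h x))
      = TensorProduct.map LinearMap.id (T.ucomul hbc) (T.ucomul h' x) := by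
  subst hab hbc h
  have hc := LinearMap.congr_fun (T.ax.hcoassoc a b c) (T.α _ (T.α _ x))
  simp only [LinearMap.comp_apply, LinearEquiv.coe_coe] at hc
  have hcst : ∀ {u v : G} (e : u = v) (y : H u),
      cst k e (T.α u y) = T.α v (cst k e y) := by
    intro u v e y; subst e; rfl
  rw [hcst, hcst, comul_α, comul_α, comul_α, comul_α] at hc
  simp only [ucomul, cst_rfl, LinearMap.comp_apply, LinearEquiv.coe_coe, LinearMap.id_apply]
  rw [hcst, comul_α, comul_α]
  have hl : ∀ t : H (a * b) ⊗[k] H c,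
      TensorProduct.map (T.comul a b) (T.α c).symm.toLinearMap
        (TensorProduct.map (T.α (a * b)).toLinearMap (T.α c).toLinearMap t)
      = TensorProduct.map ((T.comul a b).comp (T.α (a * b)).toLinearMap) LinearMap.id t := by
    intro t
    rw [← LinearMap.comp_apply, ← TensorProduct.map_comp]
    simp
  have hr : ∀ t : H a ⊗[k] H (b * c),
      TensorProduct.map (T.α a).symm.toLinearMap (T.comul b c)
        (TensorProduct.map (T.α a).toLinearMap (T.α (b * c)).toLinearMap t)
      = TensorProduct.map LinearMap.id ((T.comul b c).comp (T.α (b * c)).toLinearMap) t := by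
    intro t
    rw [← LinearMap.comp_apply, ← TensorProduct.map_comp]
    simp
  rw [hl, hr] at hc
  exact hc.symm

/-- Convolution of graded linear maps into an algebra. -/
def conv {B : Type*} [AddCommGroup B] [Module k B] (mB : B →ₗ[k] B →ₗ[k] B)
    {a b c : G} (h : a * b = c) (f : H a →ₗ[k] B) (g : H b →ₗ[k] B) : H c →ₗ[k] B :=
  (TensorProduct.lift (mB.compl₁₂ f g)).comp (T.ucomul h)

section Conv

variable {B : Type*} [AddCommGroup B] [Module k B] (mB : B →ₗ[k] B →ₗ[k] B) (oneB : B)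

theorem conv_assoc (hB : ∀ x y z, mB (mB x y) z = mB x (mB y z))
    {a b c ab bc d : G} (hab : a * b = ab) (hbc : b * c = bc) (h : ab * c = d)
    (h' : a * bc = d) (f : H a →ₗ[k] B) (g : H b →ₗ[k] B) (e : H c →ₗ[k] B) :
    T.conv mB h (T.conv mB hab f g) e = T.conv mB h' f (T.conv mB hbc g e) := by
  ext x
  have key := congrArg (TensorProduct.lift (mB.compl₁₂ f (TensorProduct.lift (mB.compl₁₂ g e))))
    (T.ucoassoc hab hbc h h' x)
  have h1 : ∀ t : H ab ⊗[k] H c,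
      TensorProduct.lift (mB.compl₁₂ (T.conv mB hab f g) e) t
        = TensorProduct.lift (mB.compl₁₂ f (TensorProduct.lift (mB.compl₁₂ g e)))
          (TensorProduct.assoc k (H a) (H b) (H c)
            (TensorProduct.map (T.ucomul hab) LinearMap.id t)) := by
    intro t
    induction t with
    | zero => simp
    | add u v hu hv => simp only [map_add, hu, hv]
    | tmul u v =>
      simp only [conv, TensorProduct.lift.tmul, LinearMap.compl₁₂_apply, LinearMap.comp_apply,
        TensorProduct.map_tmul, LinearMap.id_apply]
      induction T.ucomul hab u with
      | zero => simp
      | add u v hu hv => simp only [map_add, hu, hv, LinearMap.add_apply, TensorProduct.add_tmul]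
      | tmul u v => simp [hB]
  have h2 : ∀ t : H a ⊗[k] H bc,
      TensorProduct.lift (mB.compl₁₂ f (T.conv mB hbc g e)) t
        = TensorProduct.lift (mB.compl₁₂ f (TensorProduct.lift (mB.compl₁₂ g e)))
            (TensorProduct.map LinearMap.id (T.ucomul hbc) t) := by
    intro t
    induction t with
    | zero => simp
    | add u v hu hv => simp only [map_add, hu, hv]
    | tmul u v => simp [conv]
  calc _ = _ := h1 _
    _ = _ := key
    _ = _ := (h2 _).symm

theorem counit_conv (h1 : ∀ x, mB oneB x = x) {a : G} (h : 1 * a = a) (f : H a →ₗ[k] B) :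
    T.conv mB h (T.counit.smulRight oneB) f = f := by
  ext x
  have key := congrArg f (T.ax.counit_comul' a (T.α a x))
  rw [LinearEquiv.symm_apply_apply] at key
  rw [← key]
  change TensorProduct.lift _ (T.comul 1 a (cst k _ (T.α a x))) = _
  induction T.comul 1 a (cst k _ (T.α a x)) with
  | zero => simp
  | add u v hu hv => simp only [map_add, hu, hv]
  | tmul u v => simp [h1]

theorem conv_counit (h1 : ∀ x, mB x oneB = x) {a : G} (h : a * 1 = a) (f : H a →ₗ[k] B) :
    T.conv mB h f (T.counit.smulRight oneB) = f := by
  ext x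
  have key := congrArg f (T.ax.comul_counit' a (T.α a x))
  rw [LinearEquiv.symm_apply_apply] at key
  rw [← key]
  change TensorProduct.lift _ (T.comul a 1 (cst k _ (T.α a x))) = _
  induction T.comul a 1 (cst k _ (T.α a x)) with
  | zero => simp
  | add u v hu hv => simp only [map_add, hu, hv]
  | tmul u v => simp [h1]

theorem counit_α (x : H (1 : G)) : T.counit (T.α 1 x) = T.counit x := by
  rw [← T.ax.counit_αinv, LinearEquiv.symm_apply_apply]

theorem αsymm_one (p : G) : (T.α p).symm (T.one p) = T.one p := by
  rw [LinearEquiv.symm_apply_eq, T.ax.α_one]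

/-- Composing an algebra map with the antipode gives a left convolution inverse. -/
theorem conv_antipode_left {a b : G} (f : H a →ₗ[k] B)
    (hf : ∀ x y, f (T.umul a x y) = mB (f x) (f y)) (hf1 : f (T.one a) = oneB)
    (h : a * b = 1) (h' : b * a = 1) :
    T.conv mB h' (f.comp (T.uantipode h)) f = T.counit.smulRight oneB := by
  obtain rfl : b = a⁻¹ := eq_inv_of_mul_eq_one_left h'
  ext x
  have key := congrArg (fun y => f ((T.α a).symm y)) (T.ax.antipode_left a (T.α 1 x))
  simp only [counit_α, map_smul, αsymm_one, hf1] at key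
  refine Eq.trans ?_ key
  change TensorProduct.lift _ (T.comul a⁻¹ a (cst k _ (T.α 1 x))) = _
  induction T.comul a⁻¹ a (cst k _ (T.α 1 x)) with
  | zero => simp
  | add u v hu hv => simp only [map_add, hu, hv]
  | tmul u v => simp [← hf, umul, uantipode]

/-- Composing an algebra map with the antipode gives a right convolution inverse. -/
theorem conv_antipode_right {a b : G} (f : H a →ₗ[k] B)
    (hf : ∀ x y, f (T.umul a x y) = mB (f x) (f y)) (hf1 : f (T.one a) = oneB)
    (h : a * b = 1) :
    T.conv mB h f (f.comp (T.uantipode h)) = T.counit.smulRight oneB := by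
  obtain rfl : b = a⁻¹ := eq_inv_of_mul_eq_one_right h
  ext x
  have key := congrArg (fun y => f ((T.α a).symm y)) (T.ax.antipode_right a (T.α 1 x))
  simp only [counit_α, map_smul, αsymm_one, hf1] at key
  refine Eq.trans ?_ key
  change TensorProduct.lift _ (T.comul a a⁻¹ (cst k _ (T.α 1 x))) = _
  induction T.comul a a⁻¹ (cst k _ (T.α 1 x)) with
  | zero => simp
  | add u v hu hv => simp only [map_add, hu, hv]
  | tmul u v => simp [← hf, umul, uantipode]

end Conv

/-- The antipode reverses the untwisted comultiplication. -/
theorem ucomul_uantipode {a b a' b' c c' : G} (ha : a * a' = 1) (hb : b * b' = 1)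
    (hab : a * b = c) (hba : b' * a' = c') (hc : c * c' = 1) (x : H c') :
    T.ucomul hab (T.uantipode hc x)
      = TensorProduct.map (T.uantipode ha) (T.uantipode hb)
          (TensorProduct.comm k _ _ (T.ucomul hba x)) := by
  set mB := TensorProduct.map₂ (T.umul a) (T.umul b) with hmB
  set oneB := T.one a ⊗ₜ[k] T.one b with honeB
  have mB_assoc : ∀ x y z, mB (mB x y) z = mB x (mB y z) := by
    intro x y z
    induction x with
    | zero => simp
    | add u v hu hv => simp only [map_add, hu, hv, LinearMap.add_apply]
    | tmul x x' =>
    induction y with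
    | zero => simp
    | add u v hu hv => simp only [map_add, hu, hv, LinearMap.add_apply]
    | tmul y y' =>
    induction z with
    | zero => simp
    | add u v hu hv => simp only [map_add, hu, hv]
    | tmul z z' => simp [hmB, umul_assoc]
  have one_mB : ∀ x, mB oneB x = x := by
    intro x
    induction x with
    | zero => simp
    | add u v hu hv => simp only [map_add, hu, hv]
    | tmul x x' => simp [hmB, honeB, one_umul]
  have mB_one : ∀ x, mB x oneB = x := by
    intro x
    induction x with
    | zero => simp
    | add u v hu hv => simp only [map_add, hu, hv, LinearMap.add_apply]
    | tmul x x' => simp [hmB, honeB, umul_one]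
  let i : H a →ₗ[k] H a ⊗[k] H b := (TensorProduct.mk k _ _).flip (T.one b)
  let j : H b →ₗ[k] H a ⊗[k] H b := TensorProduct.mk k _ _ (T.one a)
  have hi : ∀ x y, i (T.umul a x y) = mB (i x) (i y) := by
    intro x y; simp [i, hmB, umul_one]
  have hj : ∀ x y, j (T.umul b x y) = mB (j x) (j y) := by
    intro x y; simp [j, hmB, umul_one]
  have hD : T.conv mB hab i j = T.ucomul hab := by
    ext x
    change TensorProduct.lift _ (T.ucomul hab x) = _
    induction T.ucomul hab x with
    | zero => simp
    | add u v hu hv => simp only [map_add, hu, hv]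
    | tmul u v => simp [i, j, hmB, umul_one, one_umul]
  have hDmul : ∀ x y, T.ucomul hab (T.umul c x y) = mB (T.ucomul hab x) (T.ucomul hab y) := by
    subst hab
    intro x y
    simp only [ucomul, umul, cst_rfl, LinearMap.comp_apply, LinearMap.id_apply,
      LinearEquiv.coe_coe, LinearMap.compr₂_apply, LinearEquiv.apply_symm_apply, comul_α,
      T.ax.comul_mul]
    induction T.comul a b x with
    | zero => simp
    | add u v hu hv => simp only [map_add, hu, hv, LinearMap.add_apply]
    | tmul x x' =>
    induction T.comul a b y with
    | zero => simp
    | add u v hu hv => simp only [map_add, hu, hv]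
    | tmul y y' => simp [hmB, umul, ← T.ax.α_mul]
  have hDone : T.ucomul hab (T.one c) = oneB := by
    subst hab
    simp [ucomul, T.ax.α_one, T.ax.comul_one, honeB]
  have hc' : c' * c = 1 := mul_eq_one_comm.mp hc
  have hFD := T.conv_antipode_left mB oneB (T.ucomul hab) hDmul hDone hc hc'
  have hba' : b * c' = a' := by
    rw [← hba, ← mul_assoc, hb, one_mul]
  have hDK : T.conv mB hc (T.ucomul hab)
      (T.conv mB hba (j.comp (T.uantipode hb)) (i.comp (T.uantipode ha)))
        = T.counit.smulRight oneB := by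
    rw [← hD, T.conv_assoc mB mB_assoc hab hba' hc ha,
      ← T.conv_assoc mB mB_assoc hb hba (one_mul a') hba',
      T.conv_antipode_right mB oneB j hj rfl hb, T.counit_conv mB oneB one_mB,
      T.conv_antipode_right mB oneB i hi rfl ha]
  have hFK := T.conv_assoc mB mB_assoc hc' hc (one_mul c') (mul_one c')
    ((T.ucomul hab).comp (T.uantipode hc)) (T.ucomul hab)
    (T.conv mB hba (j.comp (T.uantipode hb)) (i.comp (T.uantipode ha)))
  rw [hFD, hDK, T.counit_conv mB oneB one_mB, T.conv_counit mB oneB mB_one] at hFK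
  refine (LinearMap.congr_fun hFK x).symm.trans ?_
  change TensorProduct.lift _ (T.ucomul hba x) = _
  induction T.ucomul hba x with
  | zero => simp
  | add u v hu hv => simp only [map_add, hu, hv]
  | tmul u v => simp [i, j, hmB, umul_one, one_umul]

theorem uantipode_α {a b : G} (h : a * b = 1) (x : H b) :
    T.uantipode h (T.α b x) = T.α a (T.uantipode h x) := by
  obtain rfl : a = b⁻¹ := eq_inv_of_mul_eq_one_left h
  exact T.ax.antipode_α b x

/-- The antipode reverses the comultiplication. -/
theorem comul_uantipode {a b a' b' : G} (ha : a * a' = 1) (hb : b * b' = 1)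
    (hc : (a * b) * (b' * a') = 1) (x : H (b' * a')) :
    T.comul a b (T.uantipode hc x)
      = TensorProduct.map (T.uantipode ha) (T.uantipode hb)
          (TensorProduct.comm k _ _ (T.comul b' a' x)) := by
  have h := T.ucomul_uantipode ha hb rfl rfl hc ((T.α _).symm x)
  simpa [ucomul, ← uantipode_α] using h

end HomTC

/-- The braiding on pure tensors. -/
theorem braid_tmul (T : HomTC k G H) (w : G) {M W : Type*} [AddCommGroup M] [Module k M]
    [AddCommGroup W] [Module k W] (μ : M ≃ₗ[k] M) (ρM : ∀ r : G, M →ₗ[k] M ⊗[k] H r)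
    (actW : H w →ₗ[k] W →ₗ[k] W) (φW : W ≃ₗ[k] W) {w' : G} (h : w * w' = 1) (m : M) (x : W) :
    braid k T w μ ρM actW φW (m ⊗ₜ x)
      = TensorProduct.map ((actW.flip (φW.symm x)).comp (T.uantipode h)) μ.toLinearMap
          (TensorProduct.comm k _ _ (ρM w' m)) := by
  obtain rfl : w' = w⁻¹ := eq_inv_of_mul_eq_one_right h
  simp only [braid, LinearMap.comp_apply, TensorProduct.map_tmul, LinearEquiv.coe_coe]
  induction ρM w⁻¹ m with
  | zero => simp
  | add u v hu hv => simp only [map_add, TensorProduct.add_tmul, hu, hv]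
  | tmul u v => simp [HomTC.uantipode]

end Antipode

/-- The first hexagon axiom for the braiding. -/
theorem statement14 {k : Type*} [Field k] {G : Type*} [Group G] {H : G → Type*}
    [∀ p, AddCommGroup (H p)] [∀ p, Module k (H p)]
    (T : HomTC k G H) (p q s : G)
    (M : Type*) [AddCommGroup M] [Module k M] (N : Type*) [AddCommGroup N] [Module k N]
    (X : Type*) [AddCommGroup X] [Module k X]
    (μ : M ≃ₗ[k] M) (actM : H p →ₗ[k] M →ₗ[k] M) (ρM : ∀ r : G, M →ₗ[k] M ⊗[k] H r)
    (ν : N ≃ₗ[k] N) (actN : H q →ₗ[k] N →ₗ[k] N) (ρN : ∀ r : G, N →ₗ[k] N ⊗[k] H r)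
    (η : X ≃ₗ[k] X) (actX : H s →ₗ[k] X →ₗ[k] X) (ρX : ∀ r : G, X →ₗ[k] X ⊗[k] H r)
    (hM : IsYD k T p μ actM ρM) (hN : IsYD k T q ν actN ρN) (hX : IsYD k T s η actX ρX) :
    (TensorProduct.map LinearMap.id (braid k T s μ ρM actX η)).comp
      ((homAssoc k ν η).toLinearMap.comp
        (TensorProduct.map (braid k T q μ ρM actN ν) LinearMap.id))
    = (homAssoc k ν μ).toLinearMap.comp
        ((braid k T (q * s) μ ρM (tAct k T q s actN actX) (TensorProduct.congr ν η)).comp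
          (homAssoc k μ η).toLinearMap) := by
  have hq : q * q⁻¹ = 1 := mul_inv_cancel q
  have hs : s * s⁻¹ = 1 := mul_inv_cancel s
  have hqs : q * s * (s⁻¹ * q⁻¹) = 1 := by group
  refine TensorProduct.ext_threefold fun m n x => ?_
  let Φ : M ⊗[k] (H s⁻¹ ⊗[k] H q⁻¹) →ₗ[k] N ⊗[k] (X ⊗[k] M) :=
    (TensorProduct.map
        ((actN.flip n).comp ((T.uantipode hq).comp
          ((T.α q⁻¹).toLinearMap.comp (T.α q⁻¹).toLinearMap)))
        ((TensorProduct.map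
          ((actX.flip (η.symm (η.symm x))).comp
            ((T.uantipode hs).comp (T.α s⁻¹).toLinearMap))
          (μ.toLinearMap.comp μ.toLinearMap)).comp
            (TensorProduct.comm k M (H s⁻¹)).toLinearMap)).comp
      ((TensorProduct.comm k _ _).toLinearMap.comp
        (TensorProduct.assoc k M (H s⁻¹) (H q⁻¹)).symm.toLinearMap)
  have hcoassoc := congrArg Φ (LinearMap.congr_fun (hM.ρ_coassoc s⁻¹ q⁻¹) m)
  refine Eq.trans ?_ (hcoassoc.symm.trans ?_)
  · simp only [LinearMap.comp_apply, TensorProduct.map_tmul, LinearMap.id_apply,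
      LinearEquiv.coe_coe]
    rw [braid_tmul T q μ ρM actN ν hq]
    induction ρM q⁻¹ m with
    | zero => simp
    | add u v hu hv => simp only [map_add, TensorProduct.add_tmul, hu, hv]
    | tmul m₀ h =>
      have hμ := LinearMap.congr_fun (hM.ρ_μ s⁻¹) m₀
      simp only [LinearMap.comp_apply, LinearEquiv.coe_coe] at hμ
      simp only [TensorProduct.comm_tmul, TensorProduct.map_tmul, LinearMap.comp_apply,
        LinearEquiv.coe_coe, homAssoc, LinearEquiv.trans_apply, TensorProduct.assoc_tmul,
        TensorProduct.congr_tmul, LinearEquiv.refl_apply, LinearMap.id_apply]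
      rw [braid_tmul T s μ ρM actX η hs, hμ]
      induction ρM s⁻¹ m₀ with
      | zero => simp
      | add u v hu hv =>
        simp only [map_add, TensorProduct.add_tmul, TensorProduct.tmul_add, hu, hv]
      | tmul m₁ g => simp [Φ, hN.μ_act, HomTC.uantipode_α]
  · simp only [LinearMap.comp_apply, LinearEquiv.coe_coe, homAssoc, LinearEquiv.trans_apply,
      TensorProduct.assoc_tmul, TensorProduct.congr_tmul, LinearEquiv.refl_apply]
    have hμ := LinearMap.congr_fun (hM.ρ_μ (s⁻¹ * q⁻¹)) m
    simp only [LinearMap.comp_apply, LinearEquiv.coe_coe] at hμ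
    rw [braid_tmul T (q * s) μ ρM _ _ hqs, hμ]
    induction ρM (s⁻¹ * q⁻¹) m with
    | zero => simp
    | add u v hu hv => simp only [map_add, hu, hv]
    | tmul m₀ h =>
      simp only [TensorProduct.comm_tmul, TensorProduct.map_tmul, LinearMap.comp_apply,
        LinearEquiv.coe_coe, LinearMap.flip_apply, tAct, TensorProduct.congr_symm_tmul,
        T.comul_uantipode hq hs hqs, HomTC.comul_α]
      induction T.comul s⁻¹ q⁻¹ h with
      | zero => simp
      | add u v hu hv =>
        simp only [map_add, TensorProduct.add_tmul, TensorProduct.tmul_add, LinearMap.add_apply,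
          hu, hv]
      | tmul a b => simp [Φ, hN.μ_act, HomTC.uantipode_α]
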